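/- There exists a sequence of sets x : ℕ → Set ℕ of natural numbers such that for every n, the characteristic function of x n (as a function ℕ → ℕ) is not Turing reducible to the join-with-n-omitted function J_n : ℕ → ℕ defined by J_n (Nat.pair m k) = (if m = n then 0 else if k ∈ x m then 1 else 0). In other words, for every n, x n is not computable relative to the sequence (x 0, x 1, x 2, …) with x n replaced by the empty set. -/

import Mathlib

/-- Relativized partial recursiveness: `RecursiveInOracle g f` means the partial function `f`
is computable using the total function `g` as an oracle.  This mirrors Mathlib's
`Nat.Partrec` with an extra `oracle` constructor. -/
inductive RecursiveInOracle (g : ℕ → ℕ) : (ℕ →. ℕ) → Prop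
  | zero : RecursiveInOracle g (pure 0)
  | succ : RecursiveInOracle g ↑Nat.succ
  | left : RecursiveInOracle g ↑fun n : ℕ => n.unpair.1
  | right : RecursiveInOracle g ↑fun n : ℕ => n.unpair.2
  | oracle : RecursiveInOracle g ↑g
  | pair {f h : ℕ →. ℕ} : RecursiveInOracle g f → RecursiveInOracle g h →
      RecursiveInOracle g fun n => Nat.pair <$> f n <*> h n
  | comp {f h : ℕ →. ℕ} : RecursiveInOracle g f → RecursiveInOracle g h →
      RecursiveInOracle g fun n => h n >>= f
  | prec {f h : ℕ →. ℕ} : RecursiveInOracle g f → RecursiveInOracle g h →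
      RecursiveInOracle g (Nat.unpaired fun a n =>
        n.rec (f a) fun y IH => do let i ← IH; h (Nat.pair a (Nat.pair y i)))
  | rfind {f : ℕ →. ℕ} : RecursiveInOracle g f →
      RecursiveInOracle g fun a => Nat.rfind fun n => (fun m => m = 0) <$> f (Nat.pair a n)

/-- `f` is Turing reducible to `g`: `f` is computable relative to the oracle `g`. -/
def TuringReducibleTo (f g : ℕ → ℕ) : Prop :=
  RecursiveInOracle g ↑f

/-- Codes for oracle computations. -/
inductive OCode : Type
  | zero | succ | left | right | oracle
  | pair (a b : OCode) | comp (a b : OCode) | prec (a b : OCode) | rfind (a : OCode)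

namespace OCode

/-- An injective numbering of the codes. -/
def num : OCode → ℕ
  | zero => Nat.pair 0 0
  | succ => Nat.pair 1 0
  | left => Nat.pair 2 0
  | right => Nat.pair 3 0
  | oracle => Nat.pair 4 0
  | pair a b => Nat.pair 5 (Nat.pair a.num b.num)
  | comp a b => Nat.pair 6 (Nat.pair a.num b.num)
  | prec a b => Nat.pair 7 (Nat.pair a.num b.num)
  | rfind a => Nat.pair 8 a.num

theorem num_injective : Function.Injective num := by
  intro a
  induction a with
  | zero | succ | left | right | oracle =>
    intro b h; cases b <;> simp [num, Nat.pair_eq_pair] at h <;> rfl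
  | pair a b iha ihb | comp a b iha ihb | prec a b iha ihb =>
    intro c h
    cases c <;> simp [num, Nat.pair_eq_pair] at h
    rw [iha h.1, ihb h.2]
  | rfind a iha =>
    intro c h
    cases c <;> simp [num, Nat.pair_eq_pair] at h
    rw [iha h]

instance : Countable OCode := num_injective.countable

/-- Evaluation of a code relative to an oracle. -/
def eval (g : ℕ → ℕ) : OCode → (ℕ →. ℕ)
  | zero => pure 0
  | succ => ↑Nat.succ
  | left => ↑fun n : ℕ => n.unpair.1
  | right => ↑fun n : ℕ => n.unpair.2
  | oracle => ↑g
  | pair a b => fun n => Nat.pair <$> eval g a n <*> eval g b n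
  | comp a b => fun n => eval g b n >>= eval g a
  | prec a b => Nat.unpaired fun x n =>
        n.rec (eval g a x) fun y IH => do let i ← IH; eval g b (Nat.pair x (Nat.pair y i))
  | rfind a => fun x => Nat.rfind fun n => (fun m => m = 0) <$> eval g a (Nat.pair x n)

theorem exists_code {g : ℕ → ℕ} {f : ℕ →. ℕ} (h : RecursiveInOracle g f) :
    ∃ c, eval g c = f := by
  induction h with
  | zero => exact ⟨zero, rfl⟩
  | succ => exact ⟨succ, rfl⟩
  | left => exact ⟨left, rfl⟩
  | right => exact ⟨right, rfl⟩
  | oracle => exact ⟨oracle, rfl⟩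
  | pair _ _ h1 h2 =>
    obtain ⟨a, rfl⟩ := h1; obtain ⟨b, rfl⟩ := h2; exact ⟨pair a b, rfl⟩
  | comp _ _ h1 h2 =>
    obtain ⟨a, rfl⟩ := h1; obtain ⟨b, rfl⟩ := h2; exact ⟨comp a b, rfl⟩
  | prec _ _ h1 h2 =>
    obtain ⟨a, rfl⟩ := h1; obtain ⟨b, rfl⟩ := h2; exact ⟨prec a b, rfl⟩
  | rfind _ h1 =>
    obtain ⟨a, rfl⟩ := h1; exact ⟨rfind a, rfl⟩

theorem isOpen_bind {F : (ℕ → ℕ) → Part ℕ} {G : (ℕ → ℕ) → ℕ → Part ℕ}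
    (hF : ∀ v, IsOpen {g | v ∈ F g}) (hG : ∀ i v, IsOpen {g | v ∈ G g i}) (v : ℕ) :
    IsOpen {g | v ∈ (F g).bind (G g)} := by
  have : {g | v ∈ (F g).bind (G g)} = ⋃ i, ({g | i ∈ F g} ∩ {g | v ∈ G g i}) := by
    ext g; simp [Part.mem_bind_iff]
  rw [this]
  exact isOpen_iUnion fun i => (hF i).inter (hG i v)

/-- The use principle: halting with a given value is an open condition on the oracle. -/
theorem isOpen_eval (c : OCode) : ∀ n v, IsOpen {g : ℕ → ℕ | v ∈ eval g c n} := by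
  induction c with
  | zero | succ | left | right =>
    intro n v
    simp only [eval]
    exact isOpen_const
  | oracle =>
    intro n v
    have : {g : ℕ → ℕ | v ∈ eval g oracle n} = (fun g : ℕ → ℕ => g n) ⁻¹' {v} := by
      ext g; simp [eval, eq_comm]
    rw [this]
    exact (isOpen_discrete _).preimage (continuous_apply n)
  | pair a b iha ihb =>
    intro n v
    have : {g : ℕ → ℕ | v ∈ eval g (pair a b) n} =
        {g | v ∈ (eval g a n).bind fun i => (eval g b n).bind fun j =>
          Part.some (Nat.pair i j)} := by
      ext g; simp [eval, Seq.seq, eq_comm]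
    rw [this]
    exact isOpen_bind (fun v => iha n v)
      (fun i v => isOpen_bind (fun v => ihb n v) (G := fun _ j => Part.some (Nat.pair i j))
        (fun j v => isOpen_const) v) v
  | comp a b iha ihb =>
    intro n v
    exact isOpen_bind (fun v => ihb n v) (fun i v => iha i v) v
  | prec a b iha ihb =>
    intro n
    simp only [eval, Nat.unpaired]
    generalize n.unpair.2 = m
    induction m with
    | zero => exact fun v => iha _ v
    | succ m ih =>
      intro v
      exact isOpen_bind ih (fun i v => ihb _ v) v
  | rfind a iha =>
    intro n v
    have : {g : ℕ → ℕ | v ∈ eval g (rfind a) n} =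
        {g | 0 ∈ eval g a (Nat.pair n v)} ∩
          ⋂ m ∈ Set.Iio v, ⋃ i, {g | i + 1 ∈ eval g a (Nat.pair n m)} := by
      ext g
      simp only [Set.mem_inter_iff, Set.mem_iInter, Set.mem_iUnion, Set.mem_Iio]
      refine Nat.mem_rfind.trans ?_
      refine and_congr ?_ (forall_congr' fun m => forall_congr' fun _ => ?_)
      · simp
      · simp only [Part.map_eq_map, Part.mem_map_iff, decide_eq_false_iff_not]
        constructor
        · rintro ⟨i, hi, h0⟩
          exact ⟨i - 1, by rwa [Nat.sub_add_cancel (Nat.pos_of_ne_zero h0)]⟩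
        · rintro ⟨i, hi⟩
          exact ⟨i + 1, hi, by simp⟩
    rw [this]
    exact (iha _ _).inter ((Set.finite_Iio v).isOpen_biInter fun m _ =>
      isOpen_iUnion fun i => iha _ _)

/-- The join with column `n` omitted. -/
def J (n : ℕ) (X : ℕ → ℕ → Bool) (p : ℕ) : ℕ :=
  if p.unpair.1 = n then 0 else (X p.unpair.1 p.unpair.2).toNat

theorem continuous_bit (n k : ℕ) : Continuous fun X : ℕ → ℕ → Bool => X n k :=
  (continuous_apply k).comp (continuous_apply (A := fun _ : ℕ => ℕ → Bool) n)

theorem continuous_J (n : ℕ) : Continuous (J n) := by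
  refine continuous_pi fun p => ?_
  unfold J
  split_ifs
  · exact continuous_const
  · exact (continuous_of_discreteTopology (f := Bool.toNat)).comp (continuous_bit p.unpair.1 p.unpair.2)

/-- Flip the bit `k` of column `n`. -/
def flip (n k : ℕ) (X : ℕ → ℕ → Bool) : ℕ → ℕ → Bool :=
  fun m j => if m = n ∧ j = k then !(X m j) else X m j

theorem J_flip (n k : ℕ) (X : ℕ → ℕ → Bool) : J n (flip n k X) = J n X := by
  funext p
  unfold J flip
  split_ifs with h1 h2
  · rfl
  · exact absurd h2.1 h1
  · rfl

theorem tendsto_flip (n : ℕ) (X : ℕ → ℕ → Bool) :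
    Filter.Tendsto (fun k => flip n k X) Filter.atTop (nhds X) := by
  rw [tendsto_pi_nhds]
  intro m
  rw [tendsto_pi_nhds]
  intro j
  refine tendsto_const_nhds.congr' ?_
  filter_upwards [Filter.eventually_gt_atTop j] with k hk
  unfold flip
  rw [if_neg]
  rintro ⟨_, h⟩
  omega

/-- The sequences for which code `c` fails to compute column `n` from the others. -/
def Good (n : ℕ) (c : OCode) : Set (ℕ → ℕ → Bool) :=
  {X | ∃ k, (X n k).toNat ∉ eval (J n X) c k}

theorem dense_good (n : ℕ) (c : OCode) : Dense (interior (Good n c)) := by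
  rw [dense_iff_inter_open]
  rintro U hU ⟨X₀, hX₀⟩
  by_cases H : ∃ k v, ∃ Y ∈ U, v ∈ eval (J n Y) c k ∧ (Y n k).toNat ≠ v
  · obtain ⟨k, v, Y, hY, hv, hne⟩ := H
    refine ⟨Y, hY, ?_⟩
    rw [mem_interior]
    refine ⟨{Z | v ∈ eval (J n Z) c k} ∩ {Z | Z n k = Y n k}, ?_, ?_, hv, rfl⟩
    · rintro Z ⟨h1, h2⟩
      refine ⟨k, fun h => hne ?_⟩
      rw [← (show Z n k = Y n k from h2)]
      exact Part.mem_unique h h1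
    · refine ((isOpen_eval c k v).preimage (continuous_J n)).inter ?_
      exact (isOpen_discrete {Y n k}).preimage (continuous_bit n k)
  · push Not at H
    refine ⟨X₀, hX₀, ?_⟩
    rw [mem_interior]
    refine ⟨U, fun X hX => ?_, hU, hX₀⟩
    obtain ⟨k, hk⟩ := ((tendsto_flip n X).eventually (hU.mem_nhds hX)).exists
    refine ⟨k, fun h => ?_⟩
    have := H k _ (flip n k X) hk (by rw [J_flip]; exact h)
    simp only [flip] at this
    cases hb : X n k <;> simp [hb] at this

theorem exists_good : ∃ X : ℕ → ℕ → Bool, ∀ n c, X ∈ Good n c := by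
  have hd : Dense (⋂ p : ℕ × OCode, interior (Good p.1 p.2)) :=
    dense_iInter_of_isOpen (fun p => isOpen_interior) (fun p => dense_good p.1 p.2)
  obtain ⟨X, hX⟩ := hd.nonempty
  exact ⟨X, fun n c => interior_subset (Set.mem_iInter.1 hX (n, c))⟩

end OCode


open Classical in
/-- There is a sequence `x` of sets of naturals such that, for every `n`, the
characteristic function of `x n` is not Turing reducible to the join of the sequence
with `x n` replaced by the empty set. -/
theorem exists_seq_not_reducible_to_join_omitting_self :
    ∃ x : ℕ → Set ℕ, ∀ n : ℕ,
      ¬ TuringReducibleTo (fun k => if k ∈ x n then 1 else 0)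
        (fun p => if p.unpair.1 = n then 0 else
          if p.unpair.2 ∈ x p.unpair.1 then 1 else 0) := by
  obtain ⟨X, hX⟩ := OCode.exists_good
  refine ⟨fun n => {k | X n k = true}, fun n h => ?_⟩
  obtain ⟨c, hc⟩ := OCode.exists_code h
  obtain ⟨k, hk⟩ := hX n c
  apply hk
  have hJ : OCode.J n X = (fun p => if p.unpair.1 = n then 0 else
      @ite ℕ (p.unpair.2 ∈ {k | X p.unpair.1 k = true}) (propDecidable _) 1 0) := by
    funext p
    unfold OCode.J
    by_cases hb : X p.unpair.1 p.unpair.2 = true <;> simp [hb]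
  rw [hJ]
  have hc' := congrFun hc k
  refine (congrArg (fun P : Part ℕ => (X n k).toNat ∈ P) hc').mpr ?_
  cases hb : X n k <;> simp [hb]
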